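/- arXiv:1002.1229 — 2 statements merged into one kernel-verified Lean document; each statement's English description precedes it below -/
import Mathlib

section
/- For every i ≥ 1, a_i = a_{i−1} + b_i, where a_i is the number of Schröder prefixes in 𝒟 terminating at (i,i) and b_i is the number of Schröder prefixes in 𝒟 terminating at (i−1,i). -/
/-- A step of a lattice path: `E = (1,0)`, `N = (0,1)`, `D = (1,1)`. -/
inductive Step : Type
  | E : Step
  | N : Step
  | D : Step
  deriving DecidableEq

/-- The x-coordinate of the lattice point reached after performing the steps `q`
(starting from the origin). -/
def posX (q : List Step) : ℕ := q.count Step.E + q.count Step.D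

/-- The y-coordinate of the lattice point reached after performing the steps `q`
(starting from the origin). -/
def posY (q : List Step) : ℕ := q.count Step.N + q.count Step.D

/-- A Schröder prefix: a lattice path starting at the origin which never passes
below the line `y = x`. -/
def IsSchroderPrefix (p : List Step) : Prop :=
  ∀ q : List Step, q <+: p → posX q ≤ posY q

/-- A Schröder path of length `n`: a Schröder prefix terminating at `(n, n)`. -/
def IsSchroderPath (n : ℕ) (p : List Step) : Prop :=
  IsSchroderPrefix p ∧ posX p = n ∧ posY p = n

/-- Interchange `E` and `N` steps. -/
def revStep : Step → Step
  | Step.E => Step.N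
  | Step.N => Step.E
  | Step.D => Step.D

/-- The reversal of a Schröder path: write the steps in reverse order and
interchange `E` and `N` steps. -/
def revPath (p : List Step) : List Step := p.reverse.map revStep

/-- Words which are concatenations of blocks, each block being a single `D` step or
of the form `N^k E^k` for some `k > 0`. -/
inductive IsInnerWord : List Step → Prop
  | nil : IsInnerWord []
  | dcons {p : List Step} : IsInnerWord p → IsInnerWord (Step.D :: p)
  | peak {k : ℕ} {p : List Step} : 0 < k → IsInnerWord p →
      IsInnerWord (List.replicate k Step.N ++ List.replicate k Step.E ++ p)

/-- Words which are concatenations of blocks, each block being a single `D` step or of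
the form `N q E` where `q` is an inner word. -/
inductive IsDWord : List Step → Prop
  | nil : IsDWord []
  | dcons {p : List Step} : IsDWord p → IsDWord (Step.D :: p)
  | block {q p : List Step} : IsInnerWord q → IsDWord p →
      IsDWord (Step.N :: (q ++ Step.E :: p))

/-- Membership in `𝒟_n`: a Schröder path of length `n` of the prescribed block form. -/
def MemD (n : ℕ) (p : List Step) : Prop := IsDWord p ∧ IsSchroderPath n p

/-- Membership in `𝒟`: Schröder prefixes occurring as initial segments of some
path in `𝒟_m` for some finite `m`. -/
def MemCalD (p : List Step) : Prop := ∃ (m : ℕ) (q : List Step), p <+: q ∧ MemD m q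

/-- `p` has a level feature at `t`: a `D` step joining `(t-1, t)` to `(t, t+1)`. -/
def HasLevelFeatureAt (p : List Step) (t : ℕ) : Prop :=
  1 ≤ t ∧ ∃ q r : List Step, p = q ++ Step.D :: r ∧ posX q = t - 1 ∧ posY q = t

/-- `p` has a notch feature at `t`: an `E` step joining `(t-1, t)` to `(t, t)`
immediately followed by an `N` step joining `(t, t)` to `(t, t+1)`. -/
def HasNotchFeatureAt (p : List Step) (t : ℕ) : Prop :=
  1 ≤ t ∧ ∃ q r : List Step, p = q ++ Step.E :: Step.N :: r ∧ posX q = t - 1 ∧ posY q = t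

/-- `p` has no (level or notch) features. -/
def Featureless (p : List Step) : Prop :=
  ∀ t : ℕ, ¬ HasLevelFeatureAt p t ∧ ¬ HasNotchFeatureAt p t

/-- Auxiliary function for `psi`, processing the path left to right while keeping track of
the current height `y - x` above the diagonal: at height `1`, a `D` step (a level feature)
is replaced by `E N` (a notch feature) and vice versa; all other steps are unchanged. -/
def psiAux : ℕ → List Step → List Step
  | 1, Step.D :: rest => Step.E :: Step.N :: psiAux 1 rest
  | 1, Step.E :: Step.N :: rest => Step.D :: psiAux 1 rest
  | h, Step.N :: rest => Step.N :: psiAux (h + 1) rest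
  | h, Step.E :: rest => Step.E :: psiAux (h - 1) rest
  | h, Step.D :: rest => Step.D :: psiAux h rest
  | _, [] => []
  termination_by h l => l.length

/-- `psi p` replaces every level feature of `p` by a notch feature at the same place and
vice versa, leaving all other steps unchanged. -/
def psi (p : List Step) : List Step := psiAux 0 p

/-- `a i`: the number of Schröder prefixes in `𝒟` terminating at `(i, i)`. -/
noncomputable def aSeq (i : ℕ) : ℕ :=
  Set.ncard {p : List Step | MemCalD p ∧ posX p = i ∧ posY p = i}

/-- `b i`: the number of Schröder prefixes in `𝒟` terminating at `(i-1, i)` (and `b 0 = 0`). -/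
noncomputable def bSeq (i : ℕ) : ℕ :=
  Set.ncard {p : List Step | MemCalD p ∧ posX p + 1 = i ∧ posY p = i}

/-- `c i`: the number of featureless Schröder prefixes in `𝒟` terminating at `(i, i)`. -/
noncomputable def cSeq (i : ℕ) : ℕ :=
  Set.ncard {p : List Step | MemCalD p ∧ Featureless p ∧ posX p = i ∧ posY p = i}

/-- `d i`: the number of featureless Schröder prefixes in `𝒟` terminating at `(i-1, i)`
(and `d 0 = 0`). -/
noncomputable def dSeq (i : ℕ) : ℕ :=
  Set.ncard {p : List Step | MemCalD p ∧ Featureless p ∧ posX p + 1 = i ∧ posY p = i}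

/-- The permutation `π` (of `{1, …, n}`, 0-indexed as `Fin n`) contains the pattern `τ`
(a permutation of `{1, …, k}`, 0-indexed as `Fin k`). -/
def Contains {n k : ℕ} (π : Equiv.Perm (Fin n)) (τ : Equiv.Perm (Fin k)) : Prop :=
  ∃ f : Fin k → Fin n, StrictMono f ∧ ∀ a b : Fin k, τ a < τ b ↔ π (f a) < π (f b)

/-- The permutation `π` avoids the pattern `τ`. -/
def Avoids {n k : ℕ} (π : Equiv.Perm (Fin n)) (τ : Equiv.Perm (Fin k)) : Prop :=
  ¬ Contains π τ

/-- The reverse-complement of a permutation: `rc π (i) = (n+1) - π (n+1-i)` (1-indexed),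
i.e. `rc π (i) = rev (π (rev i))` in 0-indexed form. -/
def rc {n : ℕ} (π : Equiv.Perm (Fin n)) : Equiv.Perm (Fin n) :=
  (Fin.revPerm.trans π).trans Fin.revPerm

/-- The pattern `1243` (0-indexed: `0 ↦ 0, 1 ↦ 1, 2 ↦ 3, 3 ↦ 2`). -/
def pat1243 : Equiv.Perm (Fin 4) := Equiv.swap 2 3

/-- The pattern `2143` (0-indexed: `0 ↦ 1, 1 ↦ 0, 2 ↦ 3, 3 ↦ 2`). -/
def pat2143 : Equiv.Perm (Fin 4) := Equiv.swap 0 1 * Equiv.swap 2 3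

/-- The pattern `2134` (0-indexed: `0 ↦ 1, 1 ↦ 0, 2 ↦ 2, 3 ↦ 3`). -/
def pat2134 : Equiv.Perm (Fin 4) := Equiv.swap 0 1

theorem my_prefix_append {p a b : List Step} (h : p <+: a ++ b) :
    p <+: a ∨ ∃ r, p = a ++ r ∧ r <+: b := by
  rcases List.prefix_or_prefix_of_prefix h (List.prefix_append a b) with h1 | h1
  · exact Or.inl h1
  · obtain ⟨r, rfl⟩ := h1
    exact Or.inr ⟨r, rfl, (List.prefix_append_right_inj a).1 h⟩

theorem my_posX_append (a b : List Step) : posX (a ++ b) = posX a + posX b := by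
  simp only [posX, List.count_append]; omega

theorem my_posY_append (a b : List Step) : posY (a ++ b) = posY a + posY b := by
  simp only [posY, List.count_append]; omega

theorem my_posX_E (a : List Step) : posX (Step.E :: a) = posX a + 1 := by
  simp [posX]; omega
theorem my_posX_N (a : List Step) : posX (Step.N :: a) = posX a := by
  simp [posX]
theorem my_posX_D (a : List Step) : posX (Step.D :: a) = posX a + 1 := by
  simp [posX]; omega
theorem my_posY_E (a : List Step) : posY (Step.E :: a) = posY a := by
  simp [posY]
theorem my_posY_N (a : List Step) : posY (Step.N :: a) = posY a + 1 := by
  simp [posY]; omega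
theorem my_posY_D (a : List Step) : posY (Step.D :: a) = posY a + 1 := by
  simp [posY]; omega
theorem my_posX_nil : posX [] = 0 := rfl
theorem my_posY_nil : posY [] = 0 := rfl

theorem my_rep (k : ℕ) : posX (List.replicate k Step.N) = 0 ∧
    posY (List.replicate k Step.N) = k ∧ posX (List.replicate k Step.E) = k ∧
    posY (List.replicate k Step.E) = 0 := by
  simp [posX, posY, List.count_replicate]

theorem my_inner_bal {w : List Step} (h : IsInnerWord w) : posX w = posY w := by
  induction h with
  | nil => rfl
  | dcons _ ih => simp only [my_posX_D, my_posY_D, ih]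
  | @peak k p _ _ ih =>
    obtain ⟨h1, h2, h3, h4⟩ := my_rep k
    simp only [my_posX_append, my_posY_append]; omega

theorem my_inner_prefix {w : List Step} (h : IsInnerWord w) :
    ∀ p, p <+: w → posX p ≤ posY p ∧ (posX p = posY p → IsInnerWord p) := by
  induction h with
  | nil =>
    intro p hp
    rw [List.prefix_nil] at hp
    subst hp
    exact ⟨le_rfl, fun _ => IsInnerWord.nil⟩
  | dcons _ ih =>
    intro p hp
    rcases List.prefix_cons_iff.1 hp with rfl | ⟨t, rfl, ht⟩
    · exact ⟨le_rfl, fun _ => IsInnerWord.nil⟩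
    · obtain ⟨h1, h2⟩ := ih t ht
      simp only [my_posX_D, my_posY_D]
      exact ⟨by omega, fun h => IsInnerWord.dcons (h2 (by omega))⟩
  | @peak k w hk _ ih =>
    intro p hp
    obtain ⟨k1, k2, k3, k4⟩ := my_rep k
    rcases my_prefix_append hp with hp | ⟨r, rfl, hr⟩
    · rcases my_prefix_append hp with hp | ⟨r, rfl, hr⟩
      · rw [List.prefix_replicate_iff] at hp
        obtain ⟨_, hp⟩ := hp
        obtain ⟨j1, j2, j3, j4⟩ := my_rep p.length
        rw [← hp] at j1 j2
        refine ⟨by omega, fun h => ?_⟩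
        have : p = [] := List.length_eq_zero_iff.1 (by omega)
        subst this
        exact IsInnerWord.nil
      · rw [List.prefix_replicate_iff] at hr
        obtain ⟨hl, hr⟩ := hr
        obtain ⟨j1, j2, j3, j4⟩ := my_rep r.length
        rw [← hr] at j3 j4
        simp only [my_posX_append, my_posY_append]
        refine ⟨by omega, fun h => ?_⟩
        have : r.length = k := by omega
        rw [hr, this]
        simpa using IsInnerWord.peak hk IsInnerWord.nil
    · obtain ⟨h1, h2⟩ := ih r hr
      simp only [my_posX_append, my_posY_append]
      exact ⟨by omega, fun h => IsInnerWord.peak hk (h2 (by omega))⟩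

theorem my_D_bal {w : List Step} (h : IsDWord w) : posX w = posY w := by
  induction h with
  | nil => rfl
  | dcons _ ih => simp only [my_posX_D, my_posY_D, ih]
  | block hq _ ih =>
    have := my_inner_bal hq
    simp only [my_posX_append, my_posY_append, my_posX_N, my_posY_N, my_posX_E, my_posY_E]
    omega

theorem my_D_prefix {w : List Step} (h : IsDWord w) :
    ∀ p, p <+: w → posX p ≤ posY p ∧ (posX p = posY p → IsDWord p) ∧
      (posX p + 1 = posY p → IsDWord (p ++ [Step.E])) := by
  induction h with
  | nil =>
    intro p hp
    rw [List.prefix_nil] at hp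
    subst hp
    exact ⟨le_rfl, fun _ => IsDWord.nil, fun h => by simp [my_posX_nil, my_posY_nil] at h⟩
  | dcons _ ih =>
    intro p hp
    rcases List.prefix_cons_iff.1 hp with rfl | ⟨t, rfl, ht⟩
    · exact ⟨le_rfl, fun _ => IsDWord.nil, fun h => by simp [my_posX_nil, my_posY_nil] at h⟩
    · obtain ⟨h1, h2, h3⟩ := ih t ht
      simp only [my_posX_D, my_posY_D]
      exact ⟨by omega, fun h => IsDWord.dcons (h2 (by omega)),
        fun h => IsDWord.dcons (h3 (by omega))⟩
  | @block q w hq _ ih =>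
    intro p hp
    rcases List.prefix_cons_iff.1 hp with rfl | ⟨t, rfl, ht⟩
    · exact ⟨le_rfl, fun _ => IsDWord.nil, fun h => by simp [my_posX_nil, my_posY_nil] at h⟩
    have key : ∀ t, t <+: q → posX (Step.N :: t) ≤ posY (Step.N :: t) ∧
        (posX (Step.N :: t) = posY (Step.N :: t) → IsDWord (Step.N :: t)) ∧
        (posX (Step.N :: t) + 1 = posY (Step.N :: t) → IsDWord (Step.N :: t ++ [Step.E])) := by
      intro t ht
      obtain ⟨h1, h2⟩ := my_inner_prefix hq t ht
      simp only [my_posX_N, my_posY_N]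
      exact ⟨by omega, fun h => by omega,
        fun h => IsDWord.block (h2 (by omega)) IsDWord.nil⟩
    rcases my_prefix_append ht with ht | ⟨r, rfl, hr⟩
    · exact key t ht
    · rcases List.prefix_cons_iff.1 hr with rfl | ⟨s, rfl, hs⟩
      · exact key _ (by simp)
      · obtain ⟨h1, h2, h3⟩ := ih s hs
        have := my_inner_bal hq
        simp only [my_posX_append, my_posY_append, my_posX_N, my_posY_N, my_posX_E, my_posY_E]
        refine ⟨by omega, fun h => IsDWord.block hq (h2 (by omega)), fun h => ?_⟩
        have := IsDWord.block hq (h3 (by omega))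
        simpa using this

theorem my_D_mem {p w : List Step} (h : IsDWord w) (hp : p <+: w) : MemCalD p :=
  ⟨posX w, w, hp, h, fun q hq => (my_D_prefix h q hq).1, rfl, (my_D_bal h).symm⟩

theorem my_finite (m n : ℕ) (P : List Step → Prop) :
    {p : List Step | P p ∧ posX p = m ∧ posY p = n}.Finite := by
  haveI : Finite Step :=
    Set.finite_univ_iff.1 ((Set.toFinite {Step.E, Step.N, Step.D}).subset
      (fun x _ => by cases x <;> simp))
  refine (List.finite_length_le Step (m + n)).subset ?_
  rintro p ⟨_, h1, h2⟩
  have : ∀ p : List Step, p.length ≤ posX p + posY p := by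
    intro p
    induction p with
    | nil => simp
    | cons s t ih =>
      cases s <;> simp only [my_posX_N, my_posY_N, my_posX_E, my_posY_E, my_posX_D, my_posY_D,
        List.length_cons] <;> omega
  have := this p
  simp only [Set.mem_ofPred_eq]
  omega

theorem stmt_8 :
    ∀ i : ℕ, 1 ≤ i → aSeq i = aSeq (i - 1) + bSeq i := by
  intro i hi
  obtain ⟨i, rfl⟩ : ∃ j, i = j + 1 := ⟨i - 1, by omega⟩
  simp only [Nat.add_sub_cancel, aSeq, bSeq, Nat.add_right_cancel_iff]
  have hinj : ∀ s : Step, Function.Injective (fun p : List Step => p ++ [s]) :=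
    fun s => List.append_left_injective [s]
  rw [← Set.ncard_image_of_injective {p : List Step | MemCalD p ∧ posX p = i ∧ posY p = i}
      (hinj Step.D),
    ← Set.ncard_image_of_injective {p : List Step | MemCalD p ∧ posX p = i ∧ posY p = i + 1}
      (hinj Step.E),
    ← Set.ncard_union_eq _ ((my_finite _ _ _).image _) ((my_finite _ _ _).image _)]
  · congr 1
    ext p
    simp only [Set.mem_ofPred_eq, Set.mem_union, Set.mem_image]
    constructor
    · rintro ⟨⟨m, w, hpw, hD, hS⟩, hx, hy⟩
      rcases List.eq_nil_or_concat p with rfl | ⟨q, s, rfl⟩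
      · simp [my_posX_nil] at hx
      have hqw : q <+: w := (List.prefix_append q [s]).trans (by simpa using hpw)
      have hq : MemCalD q := my_D_mem hD hqw
      have := (my_D_prefix hD q hqw).1
      simp only [List.concat_eq_append, my_posX_append, my_posY_append] at hx hy ⊢
      cases s
      · right
        simp only [my_posX_E, my_posY_E, my_posX_nil, my_posY_nil] at hx hy
        exact ⟨q, ⟨hq, by omega, by omega⟩, rfl⟩
      · simp only [my_posX_N, my_posY_N, my_posX_nil, my_posY_nil] at hx hy
        omega
      · left
        simp only [my_posX_D, my_posY_D, my_posX_nil, my_posY_nil] at hx hy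
        exact ⟨q, ⟨hq, by omega, by omega⟩, rfl⟩
    · rintro (⟨q, ⟨⟨m, w, hpw, hD, hS⟩, hx, hy⟩, rfl⟩ | ⟨q, ⟨⟨m, w, hpw, hD, hS⟩, hx, hy⟩, rfl⟩)
      · have h := (my_D_prefix hD q hpw).2.1 (by omega)
        refine ⟨my_D_mem (w := q ++ [Step.D]) ?_ List.prefix_rfl, ?_, ?_⟩
        · have : ∀ q, IsDWord q → IsDWord (q ++ [Step.D]) := by
            intro q h
            induction h with
            | nil => exact IsDWord.dcons IsDWord.nil
            | dcons _ ih => exact IsDWord.dcons ih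
            | block hq _ ih => simpa using IsDWord.block hq ih
          exact this q h
        · rw [my_posX_append, my_posX_D, my_posX_nil]; omega
        · rw [my_posY_append, my_posY_D, my_posY_nil]; omega
      · have h := (my_D_prefix hD q hpw).2.2 (by omega)
        refine ⟨my_D_mem h List.prefix_rfl, ?_, ?_⟩
        · rw [my_posX_append, my_posX_E, my_posX_nil]; omega
        · rw [my_posY_append, my_posY_E, my_posY_nil]; omega
  · rw [Set.disjoint_left]
    rintro _ ⟨a, _, rfl⟩ ⟨b, _, h⟩
    simp at h
end

section
/- For every i ≥ 1, b_i = a_{i−1} + b_{i−1} + Σ_{j=1}^{i−1} b_j, where a_i is the number of Schröder prefixes in 𝒟 terminating at (i,i) and b_i is the number of Schröder prefixes in 𝒟 terminating at (i−1,i). -/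
inductive St : Bool → List Step → Prop
  | nil : St false []
  | d0 {p : List Step} : St false p → St false (p ++ [Step.D])
  | n0 {p : List Step} : St false p → St true (p ++ [Step.N])
  | d1 {p : List Step} : St true p → St true (p ++ [Step.D])
  | pk {p : List Step} {k : ℕ} : 0 < k → St true p →
      St true (p ++ List.replicate k Step.N ++ List.replicate k Step.E)
  | e1 {p : List Step} : St true p → St false (p ++ [Step.E])

def PkF (k : ℕ) (p : List Step) : List Step :=
  p ++ List.replicate k Step.N ++ List.replicate k Step.E

theorem posX_app (p q : List Step) : posX (p ++ q) = posX p + posX q := by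
  simp [posX]; omega
theorem posY_app (p q : List Step) : posY (p ++ q) = posY p + posY q := by
  simp [posY]; omega
theorem posX_N (k : ℕ) : posX (List.replicate k Step.N) = 0 := by
  simp [posX, List.count_replicate]
theorem posY_N (k : ℕ) : posY (List.replicate k Step.N) = k := by
  simp [posY, List.count_replicate]
theorem posX_E (k : ℕ) : posX (List.replicate k Step.E) = k := by
  simp [posX, List.count_replicate]
theorem posY_E (k : ℕ) : posY (List.replicate k Step.E) = 0 := by
  simp [posY, List.count_replicate]
theorem posX_PkF (k : ℕ) (p : List Step) : posX (PkF k p) = posX p + k := by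
  simp [PkF, posX_app, posX_N, posX_E]

theorem St.height {b : Bool} {p : List Step} (h : St b p) :
    posY p = posX p + (if b then 1 else 0) := by
  induction h with
  | nil => simp [posX, posY]
  | d0 _ ih => simp [posX_app, posY_app] at *; simp [posX, posY] at *; omega
  | n0 _ ih => simp [posX_app, posY_app] at *; simp [posX, posY] at *; omega
  | d1 _ ih => simp [posX_app, posY_app] at *; simp [posX, posY] at *; omega
  | e1 _ ih => simp [posX_app, posY_app] at *; simp [posX, posY] at *; omega
  | pk _ _ ih => simp [posX_app, posY_app, posX_N, posY_N, posX_E, posY_E] at *; omega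

theorem St.inner {s : List Step} (hs : IsInnerWord s) :
    ∀ r, St true r → St true (r ++ s) := by
  induction hs with
  | nil => intro r h; simpa using h
  | dcons _ ih => intro r h; simpa using ih _ h.d1
  | peak hk _ ih => intro r h; simpa using ih _ (St.pk hk h)

theorem St.dword {s : List Step} (hs : IsDWord s) :
    ∀ r, St false r → St false (r ++ s) := by
  induction hs with
  | nil => intro r h; simpa using h
  | dcons _ ih => intro r h; simpa using ih _ h.d0
  | block hq _ ih => intro r h; simpa using ih _ (St.inner hq _ h.n0).e1

theorem inner_app {s t : List Step} (hs : IsInnerWord s) (ht : IsInnerWord t) :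
    IsInnerWord (s ++ t) := by
  induction hs with
  | nil => simpa using ht
  | dcons _ ih => exact ih.dcons
  | peak hk _ ih => rw [List.append_assoc]; exact .peak hk ih

theorem dword_app {s t : List Step} (hs : IsDWord s) (ht : IsDWord t) :
    IsDWord (s ++ t) := by
  induction hs with
  | nil => simpa using ht
  | dcons _ ih => exact ih.dcons
  | block hq _ ih => simpa using IsDWord.block hq ih

theorem St.toWord {b : Bool} {p : List Step} (h : St b p) :
    if b then ∃ r s, IsDWord r ∧ IsInnerWord s ∧ p = r ++ Step.N :: s else IsDWord p := by
  induction h with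
  | nil => simpa using IsDWord.nil
  | d0 _ ih => simp at *; exact dword_app ih (.dcons .nil)
  | @n0 p _ ih => simp at *; exact ⟨p, ih, [], .nil, rfl⟩
  | d1 _ ih =>
    simp at *
    obtain ⟨r, hr, s, hs, rfl⟩ := ih
    exact ⟨r, hr, s ++ [Step.D], inner_app hs (.dcons .nil), by simp⟩
  | @pk p k hk _ ih =>
    simp at *
    obtain ⟨r, hr, s, hs, rfl⟩ := ih
    exact ⟨r, hr, _, inner_app hs (.peak hk .nil), by simp⟩
  | e1 _ ih =>
    simp at *
    obtain ⟨r, hr, s, hs, rfl⟩ := ih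
    simpa using dword_app hr (.block hs .nil)

def Cls (q : List Step) : Prop := (∃ b, St b q) ∨
  ∃ p k l, St true p ∧ l ≤ k ∧ q = p ++ List.replicate k Step.N ++ List.replicate l Step.E

theorem Cls.drop {q : List Step} {x : Step} (h : Cls (q ++ [x])) : Cls q := by
  have key : ∀ p k l, St true p → l ≤ k →
      q ++ [x] = p ++ List.replicate k Step.N ++ List.replicate l Step.E → 0 < k → Cls q := by
    intro p k l hp hl h hk
    rcases l with _ | l
    · obtain ⟨k, rfl⟩ : ∃ k', k = k' + 1 := ⟨k - 1, by omega⟩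
      rw [List.replicate_succ'] at h
      simp only [List.replicate_zero, List.append_nil, ← List.append_assoc] at h
      obtain ⟨rfl, -⟩ := List.append_inj' h rfl
      exact Or.inr ⟨p, k, 0, hp, by omega, by simp⟩
    · rw [List.replicate_succ' (n := l)] at h
      simp only [← List.append_assoc] at h
      obtain ⟨rfl, -⟩ := List.append_inj' h rfl
      exact Or.inr ⟨p, k, l, hp, by omega, by simp⟩
  have key2 : ∀ b, St b (q ++ [x]) → Cls q := by
    intro b hb
    generalize hw : q ++ [x] = w at hb
    cases hb with
    | nil => simp at hw
    | d0 h => obtain ⟨rfl, -⟩ := List.append_inj' hw rfl; exact Or.inl ⟨_, h⟩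
    | n0 h => obtain ⟨rfl, -⟩ := List.append_inj' hw rfl; exact Or.inl ⟨_, h⟩
    | d1 h => obtain ⟨rfl, -⟩ := List.append_inj' hw rfl; exact Or.inl ⟨_, h⟩
    | e1 h => obtain ⟨rfl, -⟩ := List.append_inj' hw rfl; exact Or.inl ⟨_, h⟩
    | pk hk h => exact key _ _ _ h le_rfl hw hk
  rcases h with ⟨b, hb⟩ | ⟨p, k, l, hp, hl, h⟩
  · exact key2 b hb
  · rcases Nat.eq_zero_or_pos k with rfl | hk
    · obtain rfl : l = 0 := by omega
      simp at h
      exact key2 true (h ▸ hp)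
    · exact key p k l hp hl h hk

theorem Cls.pre {q : List Step} (t : List Step) : Cls (q ++ t) → Cls q := by
  induction t using List.reverseRecOn with
  | nil => simp
  | append_singleton t x ih =>
    intro h
    rw [← List.append_assoc] at h
    exact ih h.drop

theorem Cls.le {q : List Step} (h : Cls q) : posX q ≤ posY q := by
  rcases h with ⟨b, hb⟩ | ⟨p, k, l, hp, hl, rfl⟩
  · have := hb.height; omega
  · have := hp.height
    simp [posX_app, posY_app, posX_N, posY_N, posX_E, posY_E] at *; omega

theorem St.memCalD0 {p : List Step} (h : St false p) : MemCalD p := by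
  refine ⟨posX p, p, List.prefix_rfl, by simpa using h.toWord, ?_, rfl, by simpa using h.height⟩
  rintro q ⟨t, rfl⟩
  exact (Cls.pre t (Or.inl ⟨_, h⟩)).le

theorem St.memCalD1 {p : List Step} (h : St true p) : MemCalD p := by
  obtain ⟨m, q, hq, hm⟩ := h.e1.memCalD0
  exact ⟨m, q, (List.prefix_append _ _).trans hq, hm⟩

theorem memCalD_cls {p : List Step} (h : MemCalD p) : Cls p := by
  obtain ⟨m, q, ⟨t, rfl⟩, hm, -⟩ := h
  exact Cls.pre t (Or.inl ⟨false, by simpa using St.dword hm [] .nil⟩)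

theorem setA (i : ℕ) : {p : List Step | MemCalD p ∧ posX p = i ∧ posY p = i} =
    {p | St false p ∧ posX p = i} := by
  ext p
  constructor
  · rintro ⟨h, hx, hy⟩
    refine ⟨?_, hx⟩
    rcases memCalD_cls h with ⟨b, hb⟩ | ⟨p, k, l, hp, hl, rfl⟩
    · have := hb.height
      cases b
      · exact hb
      · simp at this; omega
    · have := hp.height
      simp [posX_app, posY_app, posX_N, posY_N, posX_E, posY_E] at *; omega
  · rintro ⟨h, hx⟩
    have := h.height
    simp at this
    exact ⟨h.memCalD0, hx, by omega⟩

theorem setB (i : ℕ) : {p : List Step | MemCalD p ∧ posX p + 1 = i ∧ posY p = i} =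
    {p | St true p ∧ posX p + 1 = i} := by
  ext p
  constructor
  · rintro ⟨h, hx, hy⟩
    refine ⟨?_, hx⟩
    rcases memCalD_cls h with ⟨b, hb⟩ | ⟨p, k, l, hp, hl, rfl⟩
    · have := hb.height
      cases b
      · simp at this; omega
      · exact hb
    · have := hp.height
      simp [posX_app, posY_app, posX_N, posY_N, posX_E, posY_E] at hx hy this
      obtain rfl : l = k := by omega
      rcases Nat.eq_zero_or_pos l with rfl | hk
      · simpa using hp
      · exact hp.pk hk
  · rintro ⟨h, hx⟩
    have := h.height
    simp at this
    exact ⟨h.memCalD1, hx, by omega⟩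

def SA (i : ℕ) : Set (List Step) := {p | St false p ∧ posX p = i}
def SB (i : ℕ) : Set (List Step) := {p | St true p ∧ posX p + 1 = i}

theorem aSeq_eq (i : ℕ) : aSeq i = (SA i).ncard := by rw [aSeq, setA]; rfl
theorem bSeq_eq (i : ℕ) : bSeq i = (SB i).ncard := by rw [bSeq, setB]; rfl

theorem finStep : Finite Step :=
  Finite.of_surjective (fun n : Fin 3 => ![Step.E, Step.N, Step.D] n) (by
    intro s
    cases s
    · exact ⟨0, rfl⟩
    · exact ⟨1, rfl⟩
    · exact ⟨2, rfl⟩)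

theorem len_le (p : List Step) : p.length ≤ posX p + posY p := by
  induction p with
  | nil => simp
  | cons a p ih => cases a <;> simp [posX, posY] at * <;> omega

theorem finSt (b : Bool) (n : ℕ) : {p | St b p ∧ posX p ≤ n}.Finite := by
  haveI := finStep
  refine (List.finite_length_le Step (2 * n + 1)).subset ?_
  rintro p ⟨h, hx⟩
  have h1 := h.height
  have h2 := len_le p
  simp only [Set.mem_setOf_eq]
  split_ifs at h1 <;> omega

theorem finSA (i : ℕ) : (SA i).Finite :=
  (finSt false i).subset fun _ h => ⟨h.1, h.2.le⟩
theorem finSB (i : ℕ) : (SB i).Finite :=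
  (finSt true i).subset fun _ h => ⟨h.1, by have := h.2; omega⟩

theorem PkF_ne {k l : ℕ} {p q : List Step} (hk : 0 < k) (h : k < l) : PkF k p ≠ PkF l q := by
  intro e
  obtain ⟨k, rfl⟩ : ∃ k', k = k' + 1 := ⟨k - 1, by omega⟩
  obtain ⟨m, rfl⟩ : ∃ m, l = (m + 1) + (k + 1) := ⟨l - k - 2, by omega⟩
  rw [PkF, PkF, List.replicate_add (m + 1) (k + 1) Step.E, ← List.append_assoc] at e
  have e2 := (List.append_inj' e rfl).1
  rw [List.replicate_succ' (n := k), List.replicate_succ' (n := m), ← List.append_assoc,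
    ← List.append_assoc] at e2
  have e3 := (List.append_inj' e2 rfl).2
  simp at e3

theorem PkF_last {k : ℕ} {p q : List Step} {x : Step} (hk : 0 < k) (h : q ++ [x] = PkF k p) :
    x = Step.E := by
  obtain ⟨k, rfl⟩ : ∃ k', k = k' + 1 := ⟨k - 1, by omega⟩
  rw [PkF, List.replicate_succ' (n := k) (a := Step.E), ← List.append_assoc] at h
  have := (List.append_inj' h rfl).2
  simpa using this

theorem SB_succ (n : ℕ) : SB (n + 1) = ((· ++ [Step.N]) '' SA n ∪ (· ++ [Step.D]) '' SB n) ∪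
    ⋃ j ∈ (↑(Finset.Icc 1 n) : Set ℕ), PkF (n + 1 - j) '' SB j := by
  have xN : posX [Step.N] = 0 := rfl
  have xD : posX [Step.D] = 1 := rfl
  ext w
  constructor
  · rintro ⟨h, hx⟩
    cases h with
    | @n0 p h =>
      rw [posX_app, xN] at hx
      exact Or.inl (Or.inl ⟨p, ⟨h, by omega⟩, rfl⟩)
    | @d1 p h =>
      rw [posX_app, xD] at hx
      exact Or.inl (Or.inr ⟨p, ⟨h, by omega⟩, rfl⟩)
    | @pk p k hk h =>
      have hx' : posX (PkF k p) + 1 = n + 1 := hx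
      rw [posX_PkF] at hx'
      refine Or.inr ?_
      simp only [Set.mem_iUnion]
      refine ⟨posX p + 1, ?_, p, ⟨h, rfl⟩, ?_⟩
      · simp; omega
      · rw [show n + 1 - (posX p + 1) = k by omega]; rfl
  · rintro ((⟨p, ⟨h, hx⟩, rfl⟩ | ⟨p, ⟨h, hx⟩, rfl⟩) | h)
    · exact ⟨h.n0, by simp only [posX_app, xN]; omega⟩
    · exact ⟨h.d1, by simp only [posX_app, xD]; omega⟩
    · simp only [Set.mem_iUnion] at h
      obtain ⟨j, hj, p, ⟨h, hx⟩, rfl⟩ := h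
      simp at hj
      exact ⟨h.pk (by omega), by rw [posX_PkF]; omega⟩

theorem PkF_inj (k : ℕ) : Function.Injective (PkF k) := by
  intro p q h
  simpa [PkF] using h

theorem stmt_9 :
    ∀ i : ℕ, 1 ≤ i →
      bSeq i = aSeq (i - 1) + bSeq (i - 1) + ∑ j ∈ Finset.Icc 1 (i - 1), bSeq j := by
  intro i hi
  obtain ⟨n, rfl⟩ : ∃ n, i = n + 1 := ⟨i - 1, by omega⟩
  simp only [Nat.add_sub_cancel, aSeq_eq, bSeq_eq]
  have f1 : ((· ++ [Step.N]) '' SA n).Finite := (finSA n).image _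
  have f2 : ((· ++ [Step.D]) '' SB n).Finite := (finSB n).image _
  have f3 : (⋃ j ∈ (↑(Finset.Icc 1 n) : Set ℕ), PkF (n + 1 - j) '' SB j).Finite :=
    (Finset.finite_toSet _).biUnion fun j _ => (finSB j).image _
  rw [SB_succ, Set.ncard_union_eq ?_ (f1.union f2) f3, Set.ncard_union_eq ?_ f1 f2,
    Set.ncard_image_of_injective _ (List.append_left_injective _),
    Set.ncard_image_of_injective _ (List.append_left_injective _),
    Set.Finite.ncard_biUnion (Finset.finite_toSet _) (fun j _ => (finSB j).image _) ?_,
    finsum_mem_coe_finset]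
  · congr 1
    exact Finset.sum_congr rfl fun j _ => Set.ncard_image_of_injective _ (PkF_inj _)
  · intro j hj l hl hjl
    simp at hj hl
    refine Set.disjoint_left.2 ?_
    rintro w ⟨p, -, rfl⟩ ⟨q, -, hq⟩
    rcases lt_or_gt_of_ne hjl with h | h
    · exact PkF_ne (by omega) (by omega) hq
    · exact PkF_ne (by omega) (by omega) hq.symm
  · refine Set.disjoint_left.2 ?_
    rintro w ⟨p, -, rfl⟩ ⟨q, -, hq⟩
    have := (List.append_inj' hq rfl).2
    simp at this
  · refine Set.disjoint_left.2 ?_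
    rintro w h1 h2
    simp only [Set.mem_iUnion] at h2
    obtain ⟨j, hj, q, -, rfl⟩ := h2
    simp at hj
    rcases h1 with ⟨p, -, hp⟩ | ⟨p, -, hp⟩
    · exact absurd (PkF_last (by omega) hp) (by simp)
    · exact absurd (PkF_last (by omega) hp) (by simp)
end
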